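/- Let s = 2k > 2 be even. Then κ_{s−1,s+1}, the (s−1,s+1)-core of maximal size, is not an s-core; that is, its Young diagram contains a box of hook length s. -/

import Mathlib

/-- A partition: a weakly decreasing sequence of natural numbers (indexed from 0)
that is eventually zero.  `parts i` is the (i+1)-st largest part (0 if `i` exceeds
the number of parts). -/
structure NPartition where
  parts : ℕ → ℕ
  antitone : ∀ ⦃i j : ℕ⦄, i ≤ j → parts j ≤ parts i
  eventually_zero : ∃ N, ∀ i, N ≤ i → parts i = 0

namespace NPartition

/-- The size of a partition: the sum of its parts. -/
noncomputable def size (lam : NPartition) : ℕ := ∑ᶠ i, lam.parts i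

/-- The number of (positive) parts of a partition. -/
noncomputable def numParts (lam : NPartition) : ℕ := sInf {N | lam.parts N = 0}

/-- The conjugate partition: `conj.parts j` is the number of rows whose part exceeds `j`,
i.e. the length of column `j` of the Young diagram. -/
noncomputable def conj (lam : NPartition) : NPartition where
  parts := fun j => ((Finset.range lam.numParts).filter (fun i => j < lam.parts i)).card
  antitone := by
    intro a b hab
    apply Finset.card_le_card
    intro x hx
    simp only [Finset.mem_filter] at hx ⊢
    exact ⟨hx.1, lt_of_le_of_lt hab hx.2⟩
  eventually_zero := by
    refine ⟨lam.parts 0, fun j hj => ?_⟩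
    simp only [Finset.card_eq_zero, Finset.filter_eq_empty_iff]
    intro i _
    exact not_lt.mpr (le_trans (lam.antitone (Nat.zero_le i)) hj)

/-- The hook length of the box in row `i`, column `j` (both 0-indexed) of the Young
diagram: arm + leg + 1. -/
noncomputable def hookLength (lam : NPartition) (i j : ℕ) : ℕ :=
  (lam.parts i - (j + 1)) + (lam.conj.parts j - (i + 1)) + 1

/-- `lam` is an `s`-core: no box of its Young diagram has hook length `s`. -/
noncomputable def IsCore (s : ℕ) (lam : NPartition) : Prop :=
  ∀ i j, j < lam.parts i → lam.hookLength i j ≠ s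

/-- The empty partition. -/
def emptyP : NPartition := ⟨fun _ => 0, fun _ _ _ => le_rfl, ⟨0, fun _ _ => rfl⟩⟩

/-- The parts of the partition obtained from `lam` by removing the (rim) hook with
corner box `(i, j)` (0-indexed). -/
noncomputable def removeHookParts (lam : NPartition) (i j : ℕ) : ℕ → ℕ := fun r =>
  if r < i then lam.parts r
  else if r + 1 < lam.conj.parts j then lam.parts (r + 1) - 1
  else if r + 1 = lam.conj.parts j then j
  else lam.parts r

/-- `mu` is obtained from `lam` by removing a single hook of length `s`. -/
noncomputable def RemoveHookStep (s : ℕ) (lam mu : NPartition) : Prop :=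
  ∃ i j, j < lam.parts i ∧ lam.hookLength i j = s ∧
    ∀ r, mu.parts r = lam.removeHookParts i j r

/-- `core` is the `s`-core of `lam`: it is obtained from `lam` by repeatedly removing
hooks of length `s`, and no hook of length `s` remains. -/
noncomputable def HasSCore (s : ℕ) (lam core : NPartition) : Prop :=
  Relation.ReflTransGen (RemoveHookStep s) lam core ∧ IsCore s core

/-- The bead-set of `lam` with shift `k`: the set `{0, …, k-1} ∪ {h + k : h a
first-column hook length of `lam`}`.  (The first-column hook length of row `i`
(0-indexed) is `parts i + (m - (i+1))` where `m` is the number of parts.) -/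
noncomputable def beadSet (lam : NPartition) (k : ℕ) : Finset ℕ :=
  Finset.range k ∪ (Finset.range lam.numParts).image
    (fun i => lam.parts i + (lam.numParts - (i + 1)) + k)

/-- `X` is a bead-set for `lam`. -/
noncomputable def IsBeadSet (lam : NPartition) (X : Finset ℕ) : Prop :=
  ∃ k, X = lam.beadSet k

/-- The minimal bead-set of `lam` (shift `k = 0`), i.e. its set of first-column
hook lengths. -/
noncomputable def minBeadSet (lam : NPartition) : Finset ℕ := lam.beadSet 0

/-- `X` is the bead-set of `lam` normalized with respect to `s`: the size of `X`
is divisible by `s`, with the least possible shift `k`. -/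
noncomputable def IsNormalizedBeadSet (s : ℕ) (lam : NPartition) (X : Finset ℕ) : Prop :=
  ∃ k, X = lam.beadSet k ∧ (lam.beadSet k).card % s = 0 ∧
    ∀ k' < k, (lam.beadSet k').card % s ≠ 0

end NPartition

/-- Runner `i` of the `s`-abacus of the bead-set `X`:  `X_i = {j : i + j·s ∈ X}`. -/
def runner (s i : ℕ) (X : Finset ℕ) : Finset ℕ :=
  (Finset.range (X.sup id + 1)).filter (fun j => i + j * s ∈ X)

/-- The staircase partition `τ_ℓ = (ℓ, ℓ-1, …, 1)`. -/
def staircase (l : ℕ) : NPartition :=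
  ⟨fun i => l - i, fun _ _ hij => Nat.sub_le_sub_left hij l,
   ⟨l, fun i hi => Nat.sub_eq_zero_of_le hi⟩⟩

/-- `P_{s,t}`: the set of positive integers not expressible as a nonnegative integer
combination of `s` and `t`. -/
def Pst (s t : ℕ) : Set ℕ := {n | 0 < n ∧ ¬ ∃ a b : ℕ, n = a * s + b * t}


namespace NPartition

lemma numParts_spec (lam : NPartition) : lam.parts lam.numParts = 0 := by
  have : lam.numParts ∈ {N | lam.parts N = 0} := by
    apply Nat.sInf_mem
    obtain ⟨N, hN⟩ := lam.eventually_zero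
    exact ⟨N, hN N le_rfl⟩
  exact this

lemma parts_pos_iff (lam : NPartition) (i : ℕ) : 0 < lam.parts i ↔ i < lam.numParts := by
  constructor
  · intro h
    by_contra hc
    have := lam.antitone (not_lt.mp hc)
    rw [numParts_spec] at this
    omega
  · intro h
    have := Nat.notMem_of_lt_sInf h
    simp only [Set.mem_ofPred_eq] at this
    omega

lemma conj_spec (lam : NPartition) (i j : ℕ) : i < lam.conj.parts j ↔ j < lam.parts i := by
  have key : ∀ c, (∀ i, i < c ↔ j < lam.parts i) → lam.conj.parts j = c := by
    intro c hc
    have : (Finset.range lam.numParts).filter (fun i => j < lam.parts i) = Finset.range c := by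
      ext i
      simp only [Finset.mem_filter, Finset.mem_range, ← hc i]
      refine ⟨fun h => h.2, fun h => ⟨?_, h⟩⟩
      rw [← parts_pos_iff]
      have := (hc i).1 h
      omega
    change ((Finset.range lam.numParts).filter (fun i => j < lam.parts i)).card = c
    rw [this, Finset.card_range]
  classical
  have hex : ∃ N, lam.parts N ≤ j := ⟨lam.numParts, by rw [numParts_spec]; omega⟩
  have h2 : ∀ i, i < Nat.find hex ↔ j < lam.parts i := by
    intro i
    constructor
    · intro h
      have := Nat.find_min hex h
      omega
    · intro h
      by_contra hc
      have h3 := lam.antitone (not_lt.mp hc)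
      have h4 := Nat.find_spec hex
      omega
  rw [key _ h2]
  exact h2 i

/-- bead of row i -/
noncomputable def bead (lam : NPartition) (i : ℕ) : ℕ := lam.parts i + (lam.numParts - (i + 1))

lemma bead_lt (lam : NPartition) {i j : ℕ} (hij : i < j) (hj : j < lam.numParts) :
    lam.bead j < lam.bead i := by
  have := lam.antitone hij.le
  unfold bead
  omega

/-- closed bead sets give cores -/
lemma core_of_closed (lam : NPartition) (h : ℕ)
    (H : ∀ i < lam.numParts, h ≤ lam.bead i → ∃ i' < lam.numParts, lam.bead i' = lam.bead i - h) :
    IsCore h lam := by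
  intro i j hj hh
  have hi : i < lam.numParts := (lam.parts_pos_iff i).1 (by omega)
  have hc := (lam.conj_spec i j).2 hj
  have hcm : lam.conj.parts j ≤ lam.numParts := by
    by_contra hcon
    have := (lam.conj_spec lam.numParts j).1 (by omega)
    rw [numParts_spec] at this
    omega
  unfold hookLength at hh
  obtain ⟨i', hi', hb⟩ := H i hi (by unfold bead; omega)
  have hs := lam.conj_spec i' j
  unfold bead at hb
  by_cases hlt : i' < lam.conj.parts j
  · have := hs.1 hlt
    omega
  · have : ¬ j < lam.parts i' := fun h => hlt (hs.2 h)
    omega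

lemma closed_of_core (lam : NPartition) (h : ℕ) (hpos : 0 < h) (H : IsCore h lam)
    (i : ℕ) (hi : i < lam.numParts) (hb : h ≤ lam.bead i) :
    ∃ i' < lam.numParts, lam.bead i' = lam.bead i - h := by
  by_contra hcon
  push Not at hcon
  set y := lam.bead i - h with hy
  set m := lam.numParts with hm
  -- c: number of beads above y
  have hex : ∃ c, m ≤ c ∨ lam.bead c < y := ⟨m, Or.inl le_rfl⟩
  classical
  set c := Nat.find hex with hcdef
  have hspec := Nat.find_spec hex
  have hmin : ∀ i' < c, i' < m ∧ y < lam.bead i' := by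
    intro i' hi'
    have h1 := Nat.find_min hex hi'
    push Not at h1
    have h2 := hcon i' h1.1
    omega
  have hcm : c ≤ m := Nat.find_min' hex (Or.inl le_rfl)
  have hic : i < c := by
    by_contra hc
    rcases hspec with h1 | h1
    · omega
    · rcases (not_lt.mp hc).eq_or_lt with h2 | h2
      · rw [← hcdef, h2] at h1; omega
      · have := lam.bead_lt h2 hi
        rw [← hcdef] at h1
        omega
  -- y ≥ m - c
  have hyc : m - c ≤ y := by
    rcases hspec with h1 | h1
    · omega
    · rw [← hcdef] at h1
      by_cases h3 : c < m
      · have := (lam.parts_pos_iff c).2 h3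
        unfold bead at h1
        omega
      · omega
  have hparts : ∀ i', i' < c ↔ y + c - m < lam.parts i' := by
    intro i'
    constructor
    · intro h1
      have h2 := hmin (c - 1) (by omega)
      have h3 := lam.antitone (show i' ≤ c - 1 by omega)
      have h4 := h2.2
      unfold bead at h4
      omega
    · intro h1
      by_contra h2
      have h3 := lam.antitone (not_lt.mp h2)
      rcases hspec with h4 | h4
      · rw [← hcdef] at h4
        have h5 := lam.antitone h4
        rw [hm, numParts_spec] at h5
        omega
      · rw [← hcdef] at h4
        unfold bead at h4
        omega
  have hconj : lam.conj.parts (y + c - m) = c := by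
    apply le_antisymm
    · by_contra h1
      have := (hparts c).2 ((lam.conj_spec c _).1 (by omega))
      omega
    · by_contra h1
      have := (lam.conj_spec _ _).2 ((hparts (lam.conj.parts (y + c - m))).1 (by omega))
      omega
  have hji := (hparts i).1 hic
  apply H i (y + c - m) hji
  unfold hookLength
  rw [hconj]
  unfold bead at hy hb
  omega

lemma size_eq (lam : NPartition) : lam.size = ∑ i ∈ Finset.range lam.numParts, lam.parts i := by
  unfold size
  apply finsum_eq_sum_of_support_subset
  intro i hi
  simp only [Function.mem_support] at hi
  simpa using (lam.parts_pos_iff i).1 (by omega)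

/-- A partition with a prescribed bead set. -/
lemma exists_of_finset (X : Finset ℕ) (h0 : 0 ∉ X) : ∃ lam : NPartition,
    (∀ x, x ∈ X ↔ ∃ i < lam.numParts, lam.bead i = x) ∧
    lam.size + ∑ i ∈ Finset.range X.card, i = ∑ x ∈ X, x := by
  classical
  set m := X.card with hm
  let e := X.orderEmbOfFin hm.symm
  let x : ℕ → ℕ := fun i => if h : i < m then e ⟨i, h⟩ else 0
  have hx : ∀ i (h : i < m), x i = e ⟨i, h⟩ := fun i h => dif_pos h
  have hxmem : ∀ i < m, x i ∈ X := by
    intro i h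
    rw [hx i h]
    exact X.orderEmbOfFin_mem hm.symm _
  have hxlt : ∀ i j, i < j → j < m → x i < x j := by
    intro i j hij hj
    rw [hx i (by omega), hx j hj]
    exact e.strictMono (by simpa using hij)
  have hxsurj : ∀ y ∈ X, ∃ i < m, x i = y := by
    intro y hy
    have : y ∈ Set.range e := by
      rw [Finset.range_orderEmbOfFin]; exact hy
    obtain ⟨i, hi⟩ := this
    exact ⟨i, i.2, by rw [hx i i.2]; exact hi⟩
  have hxge : ∀ i < m, i < x i := by
    intro i
    induction i with
    | zero =>
      intro h
      have := hxmem 0 h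
      rcases Nat.eq_zero_or_pos (x 0) with h1 | h1
      · rw [h1] at this; exact absurd this h0
      · exact h1
    | succ n ih =>
      intro h
      have := ih (by omega)
      have := hxlt n (n + 1) (by omega) h
      omega
  have hxmono : ∀ d i, i + d < m → x i + d ≤ x (i + d) := by
    intro d
    induction d with
    | zero => intro i _; simp
    | succ d ih =>
      intro i h
      have h1 := ih i (by omega)
      have h2 := hxlt (i + d) (i + (d + 1)) (by omega) h
      omega
  let lam : NPartition := ⟨fun i => if i < m then x (m - 1 - i) - (m - 1 - i) else 0, by
    intro i j hij
    split_ifs with h1 h2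
    · have := hxmono (j - i) (m - 1 - j) (by omega)
      rw [show m - 1 - j + (j - i) = m - 1 - i by omega] at this
      omega
    · omega
    · omega
    · omega, ⟨m, fun i hi => by simp [not_lt.mpr hi]⟩⟩
  have hparts : ∀ i < m, lam.parts i = x (m - 1 - i) - (m - 1 - i) := fun i h => if_pos h
  have hparts0 : ∀ i, m ≤ i → lam.parts i = 0 := fun i h => if_neg (not_lt.mpr h)
  have hnum : lam.numParts = m := by
    apply le_antisymm
    · by_contra h
      have := (lam.parts_pos_iff m).2 (by omega)
      rw [hparts0 m le_rfl] at this
      omega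
    · by_contra h
      have h1 := numParts_spec lam
      rw [hparts _ (by omega)] at h1
      have := hxge (m - 1 - lam.numParts) (by omega)
      omega
  have hbead : ∀ i < m, lam.bead i = x (m - 1 - i) := by
    intro i h
    have := hxge (m - 1 - i) (by omega)
    unfold bead
    rw [hnum, hparts i h]
    omega
  refine ⟨lam, ?_, ?_⟩
  · intro y
    rw [hnum]
    constructor
    · intro hy
      obtain ⟨i, hi, hxi⟩ := hxsurj y hy
      refine ⟨m - 1 - i, by omega, ?_⟩
      rw [hbead _ (by omega), show m - 1 - (m - 1 - i) = i by omega, hxi]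
    · rintro ⟨i, hi, rfl⟩
      rw [hbead i hi]
      exact hxmem _ (by omega)
  · have hsum : ∑ y ∈ X, y = ∑ i ∈ Finset.range m, x i := by
      symm
      apply Finset.sum_bij (fun i _ => x i)
      · intro i hi; exact hxmem i (by simpa using hi)
      · intro i hi j hj hij
        simp only [Finset.mem_range] at hi hj
        rcases lt_trichotomy i j with h | h | h
        · have := hxlt i j h hj; omega
        · exact h
        · have := hxlt j i h hi; omega
      · intro y hy
        obtain ⟨i, hi, hxi⟩ := hxsurj y hy
        exact ⟨i, by simpa using hi, hxi⟩
      · intro i _; rfl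
    rw [size_eq, hnum, hsum, Finset.sum_congr rfl (fun i hi => hparts i (Finset.mem_range.1 hi)),
      Finset.sum_range_reflect (fun i => x i - i) m, ← Finset.sum_add_distrib]
    apply Finset.sum_congr rfl
    intro i hi
    have := hxge i (Finset.mem_range.1 hi)
    omega

end NPartition

/-- runner heights of the large core -/
def gfun (K q : ℕ) : ℕ := if q % 2 = 0 then K + 2 + q / 2 else q / 2 + 1

def bigIdx (K : ℕ) : Finset (Σ _ : ℕ, ℕ) :=
  (Finset.range (2 * K)).sigma (fun q => Finset.range (gfun K q))

def bigMap (K : ℕ) (p : Σ _ : ℕ, ℕ) : ℕ := (2 * K + 1) * p.2 + (p.1 + 1)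

def bigSet (K : ℕ) : Finset ℕ := (bigIdx K).image (bigMap K)

lemma bigMap_inj (K : ℕ) : Set.InjOn (bigMap K) (bigIdx K) := by
  rintro ⟨q, u⟩ h ⟨q', u'⟩ h' heq
  simp only [bigIdx, Finset.coe_sigma, Finset.coe_range, Set.mem_sigma_iff, Set.mem_Iio] at h h'
  simp only [bigMap] at heq
  have h1 := congrArg (· / (2 * K + 1)) heq
  rw [Nat.mul_add_div (by omega), Nat.mul_add_div (by omega), Nat.div_eq_of_lt (by omega),
    Nat.div_eq_of_lt (by omega)] at h1
  have h2 : u = u' := by omega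
  subst h2
  have h3 : q = q' := by omega
  subst h3
  rfl

lemma mem_bigSet (K x : ℕ) : x ∈ bigSet K ↔
    ∃ q u, q < 2 * K ∧ u < gfun K q ∧ (2 * K + 1) * u + (q + 1) = x := by
  simp only [bigSet, bigIdx, bigMap, Finset.mem_image, Finset.mem_sigma, Finset.mem_range]
  constructor
  · rintro ⟨⟨q, u⟩, ⟨h1, h2⟩, h3⟩
    exact ⟨q, u, h1, h2, h3⟩
  · rintro ⟨q, u, h1, h2, h3⟩
    exact ⟨⟨q, u⟩, ⟨h1, h2⟩, h3⟩

lemma bigSet_closed1 (K x : ℕ) (hx : x ∈ bigSet K) (h : 2 * K + 1 ≤ x) :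
    x - (2 * K + 1) ∈ bigSet K := by
  rw [mem_bigSet] at hx ⊢
  obtain ⟨q, u, hq, hu, rfl⟩ := hx
  rcases u with _ | u
  · omega
  · refine ⟨q, u, hq, by omega, ?_⟩
    rw [Nat.mul_succ]; omega

lemma bigSet_closed2 (K x : ℕ) (hx : x ∈ bigSet K) (h : 2 * K + 3 ≤ x) :
    x - (2 * K + 3) ∈ bigSet K := by
  rw [mem_bigSet] at hx ⊢
  obtain ⟨q, u, hq, hu, rfl⟩ := hx
  rcases u with _ | u
  · omega
  · rw [Nat.mul_succ] at h ⊢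
    unfold gfun at hu
    rcases q with _ | _ | q
    · rcases u with _ | u
      · omega
      · rw [Nat.mul_succ] at h ⊢
        refine ⟨2 * K - 1, u, by omega, ?_, by omega⟩
        unfold gfun
        simp at hu
        rw [if_neg (by omega)]
        omega
    · simp at hu
    · refine ⟨q, u, by omega, ?_, by omega⟩
      unfold gfun
      split_ifs at hu ⊢ <;> omega

lemma sum_pairs (F : ℕ → ℕ) (n : ℕ) :
    ∑ q ∈ Finset.range (2 * n), F q = ∑ p ∈ Finset.range n, (F (2 * p) + F (2 * p + 1)) := by
  induction n with
  | zero => simp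
  | succ n ih =>
    rw [show 2 * (n + 1) = 2 * n + 1 + 1 by ring, Finset.sum_range_succ, Finset.sum_range_succ, ih,
      Finset.sum_range_succ]
    ring

lemma gfun_even (K p : ℕ) : gfun K (2 * p) = K + 2 + p := by
  unfold gfun; rw [if_pos (by omega)]; omega

lemma gfun_odd (K p : ℕ) : gfun K (2 * p + 1) = p + 1 := by
  unfold gfun; rw [if_neg (by omega)]; omega

lemma bigSet_card (K : ℕ) : (bigSet K).card = 2 * K * (K + 1) := by
  rw [bigSet, Finset.card_image_of_injOn (bigMap_inj K), bigIdx, Finset.card_sigma]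
  simp only [Finset.card_range]
  rw [sum_pairs]
  simp only [gfun_even, gfun_odd]
  have : ∀ n, ∑ p ∈ Finset.range n, (K + 2 + p + (p + 1)) = n * (K + 2 + n) := by
    intro n
    induction n with
    | zero => simp
    | succ n ih => rw [Finset.sum_range_succ, ih]; ring
  rw [this]; ring

lemma sum_arith (a b n : ℕ) :
    2 * ((∑ u ∈ Finset.range n, (a * u + b) : ℕ) : ℤ) = a * n * (n - 1) + 2 * b * n := by
  induction n with
  | zero => simp
  | succ n ih =>
    rw [Finset.sum_range_succ]; push_cast at ih ⊢; linarith

lemma quad_sum (c0 c1 c2 : ℤ) (n : ℕ) :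
    6 * ∑ p ∈ Finset.range n, (c0 + c1 * p + c2 * (p : ℤ) ^ 2)
      = 6 * c0 * n + 3 * c1 * (n * (n - 1)) + c2 * ((n - 1) * n * (2 * n - 1)) := by
  induction n with
  | zero => simp
  | succ n ih =>
    rw [Finset.sum_range_succ, mul_add, ih]; push_cast; ring

lemma bigSet_sum (K : ℕ) : 6 * ((∑ x ∈ bigSet K, x : ℕ) : ℤ)
    = 4 * (K + 1) ^ 2 * K * (K + 2) + 3 * (2 * K * (K + 1)) * (2 * K * (K + 1) - 1) := by
  rw [bigSet, Finset.sum_image (bigMap_inj K), bigIdx, Finset.sum_sigma]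
  simp only [bigMap]
  rw [sum_pairs]
  simp only [gfun_even, gfun_odd]
  have h := quad_sum ((2 * K + 1) * (K + 1) * (K + 2) + 2 * (K + 2) + 4)
    ((2 * K + 1) * (2 * K + 4) + 4 * K + 18) (2 * (2 * K + 1) + 8) K
  have h2 : 2 * ((∑ p ∈ Finset.range K,
      (∑ u ∈ Finset.range (K + 2 + p), ((2 * K + 1) * u + (2 * p + 1)) +
        ∑ u ∈ Finset.range (p + 1), ((2 * K + 1) * u + (2 * p + 1 + 1))) : ℕ) : ℤ)
      = ∑ p ∈ Finset.range K, (((2 * K + 1) * (K + 1) * (K + 2) + 2 * (K + 2) + 4 : ℤ) +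
    ((2 * K + 1) * (2 * K + 4) + 4 * K + 18) * p + (2 * (2 * K + 1) + 8) * (p : ℤ) ^ 2) := by
    rw [Nat.cast_sum, Finset.mul_sum]
    apply Finset.sum_congr rfl
    intro p _
    rw [Nat.cast_add, mul_add, sum_arith, sum_arith]
    push_cast
    ring
  rw [← h2] at h
  linarith

lemma gap_sum (K : ℕ) :
    6 * ((∑ n ∈ Finset.range K, ∑ t ∈ Finset.range (2 * (K - n)),
      (1 * t + (n * (2 * K + 3) + 1)) : ℕ) : ℤ)
      = (K + 1) * K * (4 * (K + 1) ^ 2 - 2 * (K + 1) - 3) := by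
  have h := quad_sum (4 * K ^ 2 + 2 * K) (-8 * K - 2 + 4 * K * (2 * K + 3)) (4 - 4 * (2 * K + 3)) K
  have h2 : 2 * ((∑ n ∈ Finset.range K, ∑ t ∈ Finset.range (2 * (K - n)),
      (1 * t + (n * (2 * K + 3) + 1)) : ℕ) : ℤ)
      = ∑ p ∈ Finset.range K, ((4 * K ^ 2 + 2 * K : ℤ) + (-8 * K - 2 + 4 * K * (2 * K + 3)) * p
        + (4 - 4 * (2 * K + 3)) * (p : ℤ) ^ 2) := by
    rw [Nat.cast_sum, Finset.mul_sum]
    apply Finset.sum_congr rfl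
    intro p hp
    rw [sum_arith]
    push_cast [Nat.cast_sub (Finset.mem_range.1 hp).le]
    ring
  rw [← h2] at h
  linarith

/-- A bead of a triple core lies in none of the intervals `[n(s-1), n(s+1)]`. -/
lemma not_interval (K : ℕ) (κ : NPartition) (h1 : κ.IsCore (2 * K + 1))
    (h2 : κ.IsCore (2 * K + 2)) (h3 : κ.IsCore (2 * K + 3)) (n : ℕ) :
    ∀ i < κ.numParts, n * (2 * K + 1) ≤ κ.bead i → κ.bead i ≤ n * (2 * K + 3) → False := by
  induction n with
  | zero =>
    intro i hi _ hb
    have := (κ.parts_pos_iff i).2 hi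
    unfold NPartition.bead at hb
    omega
  | succ n ih =>
    intro i hi ha hb
    rw [Nat.succ_mul] at ha hb
    have hle : n * (2 * K + 1) + 2 * n = n * (2 * K + 3) := by ring
    by_cases c1 : κ.bead i ≤ n * (2 * K + 3) + (2 * K + 1)
    · obtain ⟨i', hi', he⟩ := κ.closed_of_core _ (by omega) h1 i hi (by omega)
      exact ih i' hi' (by omega) (by omega)
    · by_cases c2 : n * (2 * K + 1) + (2 * K + 3) ≤ κ.bead i
      · obtain ⟨i', hi', he⟩ := κ.closed_of_core _ (by omega) h3 i hi (by omega)
        exact ih i' hi' (by omega) (by omega)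
      · obtain ⟨i', hi', he⟩ := κ.closed_of_core _ (by omega) h2 i hi (by omega)
        exact ih i' hi' (by omega) (by omega)

lemma triple_size_le (K : ℕ) (κ : NPartition) (h1 : κ.IsCore (2 * K + 1))
    (h2 : κ.IsCore (2 * K + 2)) (h3 : κ.IsCore (2 * K + 3)) :
    κ.size ≤ ∑ n ∈ Finset.range K, ∑ t ∈ Finset.range (2 * (K - n)),
      (1 * t + (n * (2 * K + 3) + 1)) := by
  classical
  have hinj : Set.InjOn κ.bead (Finset.range κ.numParts) := by
    intro i hi j hj hij
    simp only [Finset.coe_range, Set.mem_Iio] at hi hj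
    rcases lt_trichotomy i j with h | h | h
    · have := κ.bead_lt h hj; omega
    · exact h
    · have := κ.bead_lt h hi; omega
  let g : (Σ _ : ℕ, ℕ) → ℕ := fun p => 1 * p.2 + (p.1 * (2 * K + 3) + 1)
  let I : Finset (Σ _ : ℕ, ℕ) := (Finset.range K).sigma (fun n => Finset.range (2 * (K - n)))
  have hsub : (Finset.range κ.numParts).image κ.bead ⊆ I.image g := by
    intro x hx
    obtain ⟨i, hi, rfl⟩ := Finset.mem_image.1 hx
    have hi' := Finset.mem_range.1 hi
    set n := κ.bead i / (2 * K + 1) with hn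
    have e1 : n * (2 * K + 1) ≤ κ.bead i := Nat.div_mul_le_self _ _
    have e2 : κ.bead i < (n + 1) * (2 * K + 1) := by
      rw [mul_comm]; exact Nat.lt_mul_div_succ _ (by omega)
    have e3 : n * (2 * K + 3) < κ.bead i := by
      by_contra hc
      exact not_interval K κ h1 h2 h3 n i hi' e1 (by omega)
    have hle : n * (2 * K + 1) + 2 * n = n * (2 * K + 3) := by ring
    rw [Nat.succ_mul] at e2
    refine Finset.mem_image.2 ⟨⟨n, κ.bead i - (n * (2 * K + 3) + 1)⟩, ?_, ?_⟩
    · simp only [I, Finset.mem_sigma, Finset.mem_range]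
      omega
    · simp only [g]
      omega
  calc κ.size = ∑ i ∈ Finset.range κ.numParts, κ.parts i := κ.size_eq
    _ ≤ ∑ i ∈ Finset.range κ.numParts, κ.bead i := by
        apply Finset.sum_le_sum
        intro i _
        unfold NPartition.bead
        omega
    _ = ∑ x ∈ (Finset.range κ.numParts).image κ.bead, x := by
        rw [Finset.sum_image hinj]
    _ ≤ ∑ x ∈ I.image g, x := Finset.sum_le_sum_of_subset hsub
    _ ≤ ∑ p ∈ I, g p := Finset.sum_image_le_of_nonneg (fun _ _ => Nat.zero_le _)
    _ = _ := by rw [Finset.sum_sigma]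

/-- Let `s = 2k > 2` be even.  Then `κ_{s-1,s+1}` is not an `s`-core;
that is, its Young diagram contains a box of hook length `s`. -/
theorem maximal_core_not_s_core (s k : ℕ) (hs : s = 2 * k) (hs2 : 2 < s)
    (κ : NPartition)
    (hκcore : NPartition.IsCore (s - 1) κ ∧ NPartition.IsCore (s + 1) κ)
    (hκmax : ∀ μ : NPartition,
      NPartition.IsCore (s - 1) μ → NPartition.IsCore (s + 1) μ → μ.size ≤ κ.size) :
    ¬ NPartition.IsCore s κ := by
  intro hs0
  obtain ⟨K, rfl⟩ : ∃ K, k = K + 1 := ⟨k - 1, by omega⟩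
  have hK : 1 ≤ K := by omega
  rw [show s - 1 = 2 * K + 1 by omega, show s + 1 = 2 * K + 3 by omega] at hκcore hκmax
  rw [show s = 2 * K + 2 by omega] at hs0
  have hle := triple_size_le K κ hκcore.1 hs0 hκcore.2
  have hzero : 0 ∉ bigSet K := by
    rw [mem_bigSet]
    rintro ⟨q, u, _, _, h⟩
    omega
  obtain ⟨μ, hμ, hsize⟩ := NPartition.exists_of_finset (bigSet K) hzero
  have hmax := hκmax μ
    (μ.core_of_closed _ fun i hi hb =>
      (hμ _).1 (bigSet_closed1 K _ ((hμ _).2 ⟨i, hi, rfl⟩) hb))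
    (μ.core_of_closed _ fun i hi hb =>
      (hμ _).1 (bigSet_closed2 K _ ((hμ _).2 ⟨i, hi, rfl⟩) hb))
  have hbig := bigSet_sum K
  have hgap := gap_sum K
  have htri := sum_arith 1 0 (2 * K * (K + 1))
  simp only [one_mul, add_zero] at htri
  rw [bigSet_card] at hsize
  have hsize' := congrArg (Nat.cast : ℕ → ℤ) hsize
  rw [Nat.cast_add] at hsize'
  have hle' : (μ.size : ℤ) ≤ _ := Nat.cast_le.2 (hmax.trans hle)
  push_cast at htri hsize' hle' hbig hgap
  have hK' : (1 : ℤ) ≤ K := by exact_mod_cast hK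
  have hpos : (0 : ℤ) < (K + 1) * K * (6 * K + 9) := by positivity
  nlinarith
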